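/- Let d ∈ ℕ, α ∈ (0, min(2,d)) and β ∈ (0, d-α), and set ν₁ = β/2, ν₂ = (β+α)/2. Then for every x ∈ ℝ^d \ {0}, V_β(x) - κ_β |x|^{-α} = κ_β |x|^{-α} ∫_0^{|x|} (V_β(s) / (κ_β s^{-α})) · (K_{ν₁-1}(s)/K_{ν₁}(s) - K_{ν₂-1}(s)/K_{ν₂}(s)) ds, where V_β(s) denotes the radial profile of V_β. -/

import Mathlib

open MeasureTheory Real Set Filter RealInnerProductSpace

noncomputable section

/-- Euclidean space `ℝ^d`. -/
abbrev Ed (d : ℕ) := EuclideanSpace ℝ (Fin d)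

/-- Modified Bessel function of the second kind `K_ν(r)`. -/
def besselK (ν r : ℝ) : ℝ :=
  (1 / 2) * (r / 2) ^ ν * ∫ u in Ioi (0 : ℝ), u ^ (-ν - 1) * Real.exp (-u - r ^ 2 / (4 * u))

/-- Relativistic `α`-stable heat kernel with mass parameter `m`:
`p^m(t,x,y) = (2π)^{-d} ∫ exp(-i⟨y-x,z⟩) exp(-t(|z|²+m^{2/α})^{α/2}) dz`
(the integral is real, and equals the cosine integral below). -/
def relKernel (d : ℕ) (α m t : ℝ) (x y : Ed d) : ℝ :=
  (2 * π) ^ (-(d : ℝ)) *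
    ∫ z : Ed d, Real.cos ⟪y - x, z⟫ * Real.exp (-t * (‖z‖ ^ 2 + m ^ (2 / α)) ^ (α / 2))

/-- Fractional (`α`-stable) heat kernel `p⁰(t,x,y)`. -/
def fracKernel (d : ℕ) (α t : ℝ) (x y : Ed d) : ℝ :=
  (2 * π) ^ (-(d : ℝ)) * ∫ z : Ed d, Real.cos ⟪y - x, z⟫ * Real.exp (-t * ‖z‖ ^ α)

/-- The summands of the perturbation series. -/
def pertN (d : ℕ) (k : ℝ → Ed d → Ed d → ℝ) (q : Ed d → ℝ) : ℕ → ℝ → Ed d → Ed d → ℝ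
  | 0 => k
  | n + 1 => fun t x y =>
      ∫ s in Ioo (0 : ℝ) t, ∫ z : Ed d, pertN d k q n s x z * q z * k (t - s) z y

/-- Schrödinger perturbation of a transition density `k` by a potential `q`. -/
def pert (d : ℕ) (k : ℝ → Ed d → Ed d → ℝ) (q : Ed d → ℝ) (t : ℝ) (x y : Ed d) : ℝ :=
  ∑' n : ℕ, pertN d k q n t x y

/-- Radial profile of the potential `V_β`. -/
def VProf (d : ℕ) (α β r : ℝ) : ℝ :=
  2 ^ (α / 2) * Real.Gamma (((d : ℝ) - β) / 2) / Real.Gamma (((d : ℝ) - β - α) / 2) *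
    (besselK ((β + α) / 2) r / besselK (β / 2) r) * r ^ (-(α / 2))

/-- The potential `V_β(x)`. -/
def Vbeta (d : ℕ) (α β : ℝ) (x : Ed d) : ℝ := VProf d α β ‖x‖

/-- The Hardy constant `κ_β` for the fractional Laplacian. -/
def kappa (d : ℕ) (α β : ℝ) : ℝ :=
  2 ^ α * Real.Gamma ((β + α) / 2) * Real.Gamma (((d : ℝ) - β) / 2) /
    (Real.Gamma (β / 2) * Real.Gamma (((d : ℝ) - β - α) / 2))

/-- `h^m_β(x) = ∫_0^∞ t^{(d-α-β)/α} p^m(t,x,0) dt`. -/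
def hBetaM (d : ℕ) (α m β : ℝ) (x : Ed d) : ℝ :=
  ∫ t in Ioi (0 : ℝ), t ^ (((d : ℝ) - α - β) / α) * relKernel d α m t x 0

/-- `h_β = h^1_β`. -/
def hBeta (d : ℕ) (α β : ℝ) (x : Ed d) : ℝ := hBetaM d α 1 β x

/-- `V^m_β(x) = ((d-α-β)/α) h^m_{β+α}(x)/h^m_β(x)`. -/
def VbetaM (d : ℕ) (α m β : ℝ) (x : Ed d) : ℝ :=
  (((d : ℝ) - α - β) / α) * hBetaM d α m (β + α) x / hBetaM d α m β x

/-- The function `H⁰(t,x)`. -/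
def Hzero (d : ℕ) (α δ t : ℝ) (x : Ed d) : ℝ :=
  if δ ≤ ((d : ℝ) - α) / 2 then 1 + t ^ (δ / α) * ‖x‖ ^ (-δ)
  else 1 + t ^ (((d : ℝ) - α - δ) / α) * ‖x‖ ^ (-((d : ℝ) - α - δ))

/-- Density of the Lévy measure of the relativistic `α`-stable operator (mass 1). -/
def levyNu (d : ℕ) (α : ℝ) (x : Ed d) : ℝ :=
  2 ^ ((α - (d : ℝ)) / 2 + 1) * π ^ (-(d : ℝ) / 2) * |Real.Gamma (-α / 2)|⁻¹ *
    besselK (((d : ℝ) + α) / 2) ‖x‖ / ‖x‖ ^ (((d : ℝ) + α) / 2)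

/-- Auxiliary integral. -/
def auxJ (ν c : ℝ) : ℝ := ∫ v in Ioi (0 : ℝ), v ^ (ν - 1) * Real.exp (-v - c / v)

lemma auxJ_meas (ν c : ℝ) : AEStronglyMeasurable
    (fun v : ℝ => v ^ (ν - 1) * Real.exp (-v - c / v)) (volume.restrict (Ioi 0)) := by
  apply Measurable.aestronglyMeasurable
  fun_prop

lemma auxJ_bound {ν c v : ℝ} (hc : 0 < c) (hv : 0 < v) (n : ℕ) :
    v ^ (ν - 1) * Real.exp (-v - c / v) ≤
      (n.factorial / c ^ n) * (Real.exp (-v) * v ^ (ν + n - 1)) := by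
  have h1 := Real.pow_div_factorial_le_exp (c / v) (by positivity) n
  have hf : (0 : ℝ) < n.factorial := by positivity
  have h2 : Real.exp (-(c / v)) ≤ n.factorial / c ^ n * v ^ n := by
    rw [Real.exp_neg]
    calc (Real.exp (c / v))⁻¹ ≤ ((c / v) ^ n / n.factorial)⁻¹ := by
          apply inv_anti₀ (by positivity) h1
      _ = _ := by
          rw [div_pow]
          field_simp
  have h3 : v ^ (ν + n - 1) = v ^ (ν - 1) * v ^ n := by
    rw [← Real.rpow_natCast, ← Real.rpow_add hv]; congr 1; ring
  have h4 : Real.exp (-v - c / v) = Real.exp (-v) * Real.exp (-(c / v)) := by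
    rw [← Real.exp_add]; congr 1
  rw [h3, h4]
  calc v ^ (ν - 1) * (Real.exp (-v) * Real.exp (-(c / v)))
      ≤ v ^ (ν - 1) * (Real.exp (-v) * (n.factorial / c ^ n * v ^ n)) := by gcongr
    _ = _ := by ring

lemma auxJ_integrable (ν : ℝ) {c : ℝ} (hc : 0 < c) :
    IntegrableOn (fun v : ℝ => v ^ (ν - 1) * Real.exp (-v - c / v)) (Ioi 0) := by
  obtain ⟨n, hn⟩ := exists_nat_gt (-ν)
  have hb := (Real.GammaIntegral_convergent (s := ν + n) (by linarith)).const_mul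
    ((n.factorial : ℝ) / c ^ n)
  refine Integrable.mono' hb (auxJ_meas ν c) ?_
  filter_upwards [ae_restrict_mem measurableSet_Ioi] with v hv
  have hv : 0 < v := hv
  rw [Real.norm_of_nonneg (by positivity)]
  exact auxJ_bound hc hv n

lemma auxJ_pos (ν : ℝ) {c : ℝ} (hc : 0 < c) : 0 < auxJ ν c := by
  unfold auxJ
  rw [setIntegral_pos_iff_support_of_nonneg_ae _ (auxJ_integrable ν hc)]
  · have : Function.support (fun v : ℝ => v ^ (ν - 1) * Real.exp (-v - c / v)) ∩ Ioi 0 = Ioi 0 := by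
      apply inter_eq_right.2
      intro v hv
      have hv : 0 < v := hv
      rw [Function.mem_support]
      positivity
    rw [this]
    simp
  · filter_upwards [ae_restrict_mem measurableSet_Ioi] with v hv
    have hv : 0 < v := hv
    simp only [Pi.zero_apply]
    positivity

lemma auxJ_zero {ν : ℝ} (hν : 0 < ν) : auxJ ν 0 = Real.Gamma ν := by
  rw [Real.Gamma_eq_integral hν, auxJ]
  simp [mul_comm]

lemma auxJ_cont {ν : ℝ} (hν : 0 < ν) : ContinuousOn (auxJ ν) (Ici 0) := by
  unfold auxJ
  refine continuousOn_of_dominated (bound := fun v => Real.exp (-v) * v ^ (ν - 1))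
    (fun c _ => auxJ_meas ν c) ?_ (Real.GammaIntegral_convergent hν) ?_
  · intro c hc
    have hc : 0 ≤ c := hc
    filter_upwards [ae_restrict_mem measurableSet_Ioi] with v hv
    have hv : 0 < v := hv
    rw [Real.norm_of_nonneg (by positivity), mul_comm]
    have : 0 ≤ c / v := by positivity
    gcongr
    linarith
  · filter_upwards with v
    fun_prop

lemma auxJ_deriv (ν : ℝ) {c : ℝ} (hc : 0 < c) :
    HasDerivAt (auxJ ν) (-auxJ (ν - 1) c) c := by
  have key := hasDerivAt_integral_of_dominated_loc_of_deriv_le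
    (μ := volume.restrict (Ioi (0 : ℝ)))
    (F := fun c v : ℝ => v ^ (ν - 1) * Real.exp (-v - c / v))
    (F' := fun c v : ℝ => -(v ^ (ν - 1 - 1) * Real.exp (-v - c / v)))
    (bound := fun v : ℝ => v ^ (ν - 1 - 1) * Real.exp (-v - (c / 2) / v))
    (x₀ := c) (s := Ioi (c / 2)) (Ioi_mem_nhds (by linarith))
    (Eventually.of_forall fun c => auxJ_meas ν c) (auxJ_integrable ν hc)
    (auxJ_meas (ν - 1) c).neg ?_ (auxJ_integrable (ν - 1) (by positivity)) ?_
  · have h := key.2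
    rw [integral_neg] at h
    exact h
  · filter_upwards [ae_restrict_mem measurableSet_Ioi] with v hv e he
    have hv : 0 < v := hv
    have he : c / 2 < e := he
    rw [norm_neg, Real.norm_of_nonneg (by positivity)]
    gcongr
  · filter_upwards [ae_restrict_mem measurableSet_Ioi] with v hv e he
    have hv : 0 < v := hv
    have h1 : HasDerivAt (fun e : ℝ => -v - e / v) (-(1 / v)) e :=
      ((hasDerivAt_id e).div_const v).const_sub (-v)
    have h2 := (h1.exp).const_mul (v ^ (ν - 1))
    refine h2.congr_deriv ?_
    rw [Real.rpow_sub_one hv.ne' (ν - 1)]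
    ring

lemma auxJ_symm (ν : ℝ) {c : ℝ} (hc : 0 < c) : auxJ (-ν) c = c ^ (-ν) * auxJ ν c := by
  have h1 := integral_comp_rpow_Ioi (fun v : ℝ => v ^ (-ν - 1) * Real.exp (-v - c / v))
    (p := -1) (by norm_num)
  have h2 := integral_comp_mul_left_Ioi
    (fun v : ℝ => v ^ (ν - 1) * Real.exp (-v - c / v)) 0 hc
  rw [mul_zero] at h2
  have h3 : ∫ x in Ioi (0 : ℝ), (|(-1 : ℝ)| * x ^ ((-1 : ℝ) - 1)) •
      ((x ^ (-1 : ℝ)) ^ (-ν - 1) * Real.exp (-(x ^ (-1 : ℝ)) - c / x ^ (-1 : ℝ))) =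
      ∫ x in Ioi (0 : ℝ), c ^ (1 - ν) *
        ((c * x) ^ (ν - 1) * Real.exp (-(c * x) - c / (c * x))) := by
    apply setIntegral_congr_fun measurableSet_Ioi
    intro x hx
    have hx : 0 < x := hx
    simp only [abs_neg, abs_one, one_mul, smul_eq_mul]
    rw [← Real.rpow_mul hx.le, ← mul_assoc, ← Real.rpow_add hx, Real.mul_rpow hc.le hx.le,
      ← mul_assoc, ← mul_assoc, ← Real.rpow_add hc, Real.rpow_neg_one]
    have e1 : (1 - ν + (ν - 1)) = 0 := by ring
    have e2 : (-1 - 1 + -1 * (-ν - 1)) = ν - 1 := by ring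
    rw [e1, e2, Real.rpow_zero, one_mul]
    congr 2
    field_simp
    ring
  unfold auxJ
  rw [← h1, h3, integral_const_mul, h2, smul_eq_mul, ← mul_assoc]
  congr 1
  rw [← Real.rpow_neg_one, ← Real.rpow_add hc]
  congr 1
  ring

lemma besselK_eq (ν : ℝ) {r : ℝ} (hr : 0 < r) :
    besselK ν r = (1 / 2) * (r / 2) ^ (-ν) * auxJ ν (r ^ 2 / 4) := by
  have h1 : besselK ν r = (1 / 2) * (r / 2) ^ ν * auxJ (-ν) (r ^ 2 / 4) := by
    unfold besselK auxJ
    simp only [div_div]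
  rw [h1, auxJ_symm ν (by positivity), ← mul_assoc]
  congr 1
  have : r ^ 2 / 4 = (r / 2) ^ (2 : ℝ) := by
    rw [Real.rpow_two]; ring
  rw [this, ← Real.rpow_mul (by positivity), mul_assoc, ← Real.rpow_add (by positivity)]
  congr 2
  ring

/-- `I_ν(r) = J_ν(r²/4)`. -/
def auxI (ν r : ℝ) : ℝ := auxJ ν (r ^ 2 / 4)

lemma auxI_pos {ν r : ℝ} (hr : 0 < r) : 0 < auxI ν r := auxJ_pos ν (by positivity)

lemma auxI_pos' {ν r : ℝ} (hν : 0 < ν) (hr : 0 ≤ r) : 0 < auxI ν r := by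
  rcases hr.eq_or_lt with rfl | hr
  · simp only [auxI]
    norm_num
    rw [auxJ_zero hν]
    exact Real.Gamma_pos_of_pos hν
  · exact auxI_pos hr

lemma auxI_cont {ν : ℝ} (hν : 0 < ν) (s : Set ℝ) : ContinuousOn (auxI ν) s := by
  unfold auxI
  refine (auxJ_cont hν).comp (f := fun r : ℝ => r ^ 2 / 4) (by fun_prop) ?_
  intro r _
  simp only [mem_Ici]
  positivity

lemma auxI_deriv (ν : ℝ) {r : ℝ} (hr : 0 < r) :
    HasDerivAt (auxI ν) (-(r / 2 * auxI (ν - 1) r)) r := by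
  have h1 : HasDerivAt (fun r : ℝ => r ^ 2 / 4) (r / 2) r := by
    refine ((hasDerivAt_pow 2 r).div_const 4).congr_deriv ?_
    norm_num
    ring
  have h2 := (auxJ_deriv ν (c := r ^ 2 / 4) (by positivity)).comp r h1
  refine h2.congr_deriv ?_
  unfold auxI
  ring

lemma auxI_int {ν : ℝ} (hν : 0 < ν) {R : ℝ} (hR : 0 < R) :
    IntervalIntegrable (fun r => r / 2 * auxI (ν - 1) r) volume 0 R := by
  apply intervalIntegral.intervalIntegrable_deriv_of_nonneg (g := fun r => - auxI ν r)
  · exact (auxI_cont hν _).neg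
  · intro r hr
    rw [min_eq_left hR.le] at hr
    exact (auxI_deriv ν hr.1).neg.congr_deriv (neg_neg _)
  · intro r hr
    rw [min_eq_left hR.le] at hr
    have := hr.1
    have := auxI_pos (ν := ν - 1) hr.1
    positivity

lemma ratio_eq (ν : ℝ) {r : ℝ} (hr : 0 < r) :
    besselK (ν - 1) r / besselK ν r = r / 2 * auxI (ν - 1) r / auxI ν r := by
  rw [besselK_eq _ hr, besselK_eq _ hr]
  have h1 : (r / 2) ^ (-(ν - 1)) = (r / 2) ^ (-ν) * (r / 2) := by
    rw [← Real.rpow_add_one (by positivity)]; congr 1; ring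
  rw [h1]
  have h2 : 0 < (r / 2) ^ (-ν) := by positivity
  have h3 := auxI_pos (ν := ν) hr
  unfold auxI at *
  field_simp

lemma VProf_eq {d : ℕ} {α β : ℝ} (hα : 0 < α) (hβ : 0 < β) {r : ℝ}
    (hr : 0 < r) : VProf d α β r = kappa d α β * r ^ (-α) *
      (Real.Gamma (β / 2) / Real.Gamma ((β + α) / 2) *
        (auxI ((β + α) / 2) r / auxI (β / 2) r)) := by
  unfold VProf kappa
  rw [besselK_eq _ hr, besselK_eq _ hr]
  change _ * ((1 / 2 * (r / 2) ^ (-((β + α) / 2)) * auxI ((β + α) / 2) r) /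
    (1 / 2 * (r / 2) ^ (-(β / 2)) * auxI (β / 2) r)) * _ = _
  have g1 : 0 < Real.Gamma (β / 2) := Real.Gamma_pos_of_pos (by positivity)
  have g2 : 0 < Real.Gamma ((β + α) / 2) := Real.Gamma_pos_of_pos (by positivity)
  have h1 : (r / 2) ^ (-((β + α) / 2)) =
      (r / 2) ^ (-(β / 2)) * (r ^ (-(α / 2)) * 2 ^ (α / 2)) := by
    have : (-((β + α) / 2)) = -(β / 2) + -(α / 2) := by ring
    rw [this, Real.rpow_add (by positivity), Real.div_rpow hr.le (by norm_num) (-(α / 2)),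
      Real.rpow_neg (by norm_num : (0 : ℝ) ≤ 2)]
    field_simp
  have h2 : r ^ (-α) = r ^ (-(α / 2)) * r ^ (-(α / 2)) := by
    rw [← Real.rpow_add hr]; congr 1; ring
  have h3 : (2 : ℝ) ^ α = 2 ^ (α / 2) * 2 ^ (α / 2) := by
    rw [← Real.rpow_add (by norm_num)]; congr 1; ring
  rw [h1, h2, h3]
  have h4 : 0 < (r / 2) ^ (-(β / 2)) := by positivity
  have h5 := auxI_pos (ν := β / 2) hr
  generalize r ^ (-(α / 2)) = A
  field_simp

/-- Integral representation of the difference `V_β(x) - κ_β|x|^{-α}` (Lemma 2.10). -/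
theorem stmt_10 (d : ℕ) (α β : ℝ) (hα : α ∈ Ioo 0 (min 2 (d : ℝ)))
    (hβ : β ∈ Ioo 0 ((d : ℝ) - α)) (x : Ed d) (hx : x ≠ 0) :
    Vbeta d α β x - kappa d α β * ‖x‖ ^ (-α) =
      kappa d α β * ‖x‖ ^ (-α) *
        ∫ s in Ioo (0 : ℝ) ‖x‖,
          (VProf d α β s / (kappa d α β * s ^ (-α))) *
            (besselK (β / 2 - 1) s / besselK (β / 2) s -
              besselK ((β + α) / 2 - 1) s / besselK ((β + α) / 2) s) := by
  have hα0 : 0 < α := hα.1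
  have hβ0 : 0 < β := hβ.1
  have hβ1 : β < (d : ℝ) - α := hβ.2
  have hR : 0 < ‖x‖ := norm_pos_iff.2 hx
  have hn1 : 0 < β / 2 := by positivity
  have hn2 : 0 < (β + α) / 2 := by positivity
  have g1 : 0 < Real.Gamma (β / 2) := Real.Gamma_pos_of_pos hn1
  have g2 : 0 < Real.Gamma ((β + α) / 2) := Real.Gamma_pos_of_pos hn2
  have g3 : 0 < Real.Gamma (((d : ℝ) - β) / 2) := Real.Gamma_pos_of_pos (by linarith)
  have g4 : 0 < Real.Gamma (((d : ℝ) - β - α) / 2) := Real.Gamma_pos_of_pos (by linarith)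
  have hκ : 0 < kappa d α β := by unfold kappa; positivity
  set R := ‖x‖ with hRdef
  set c := Real.Gamma (β / 2) / Real.Gamma ((β + α) / 2) with hc
  have hpos1 : ∀ s ∈ Icc 0 R, auxI (β / 2) s ≠ 0 := fun s hs => (auxI_pos' hn1 hs.1).ne'
  let G : ℝ → ℝ := fun s => (s / 2 * auxI (β / 2 - 1) s) *
      (c * auxI ((β + α) / 2) s / auxI (β / 2) s ^ 2) -
    (s / 2 * auxI ((β + α) / 2 - 1) s) * (c / auxI (β / 2) s)
  have hGint : IntervalIntegrable G volume 0 R := by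
    apply IntervalIntegrable.sub
    · apply (auxI_int hn1 hR).mul_continuousOn
      rw [uIcc_of_le hR.le]
      exact ((continuousOn_const.mul (auxI_cont hn2 _)).div ((auxI_cont hn1 _).pow 2)
        (fun s hs => pow_ne_zero 2 (hpos1 s hs)))
    · apply (auxI_int hn2 hR).mul_continuousOn
      rw [uIcc_of_le hR.le]
      exact continuousOn_const.div (auxI_cont hn1 _) hpos1
  have hFTC := intervalIntegral.integral_eq_sub_of_hasDerivAt_of_le
    (f := fun s => c * (auxI ((β + α) / 2) s / auxI (β / 2) s)) (f' := G) hR.le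
    (continuousOn_const.mul ((auxI_cont hn2 _).div (auxI_cont hn1 _) hpos1)) (by
      intro s hs
      have h0 := auxI_pos (ν := β / 2) hs.1
      have h := (((auxI_deriv ((β + α) / 2) hs.1).div (auxI_deriv (β / 2) hs.1) h0.ne').const_mul c)
      refine h.congr_deriv ?_
      simp only [G]
      field_simp
      ring) hGint
  have h00 : c * (auxI ((β + α) / 2) 0 / auxI (β / 2) 0) = 1 := by
    simp only [auxI]
    norm_num
    rw [auxJ_zero hn1, auxJ_zero hn2, hc]
    field_simp
  rw [intervalIntegral.integral_of_le hR.le, integral_Ioc_eq_integral_Ioo, h00] at hFTC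
  have hI : ∫ s in Ioo (0 : ℝ) R, (VProf d α β s / (kappa d α β * s ^ (-α))) *
            (besselK (β / 2 - 1) s / besselK (β / 2) s -
              besselK ((β + α) / 2 - 1) s / besselK ((β + α) / 2) s) =
      ∫ s in Ioo (0 : ℝ) R, G s := by
    apply setIntegral_congr_fun measurableSet_Ioo
    intro s hs
    have hs0 : 0 < s := hs.1
    have h1 := auxI_pos (ν := β / 2) hs0
    have h2 := auxI_pos (ν := (β + α) / 2) hs0
    have h3 : 0 < s ^ (-α) := by positivity
    simp only [G]
    rw [VProf_eq hα0 hβ0 hs0, ratio_eq _ hs0, ratio_eq _ hs0, mul_div_cancel_left₀ _ (by positivity)]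
    rw [← hc]
    field_simp
  rw [hI, hFTC]
  unfold Vbeta
  rw [← hRdef, VProf_eq hα0 hβ0 hR, ← hc]
  ring
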